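/- Fix a reduced expression i of w_0, and let j be an index such that β_j = α_i is a simple root. Then for all k > j, the commutator E_i F_{i;β_k} − F_{i;β_k} E_i lies in U_q^-(𝔤)·K_i. -/

import Mathlib

/-!
Common setup: the quantized universal enveloping algebra `U_q(𝔤)` of a simple
complex Lie algebra of type ADE, presented by the Chevalley generators
`E i`, `F i`, `K i`, `K i⁻¹` over `ℚ(q)`, together with the combinatorics of
words in the Weyl group, PBW root vectors and monomials, Lusztig's braid group
automorphisms, the bar involution, lattices, and partial orders on Lusztig data.
-/

noncomputable section

open scoped BigOperators

/-- The base field `ℚ(q)`. -/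
abbrev 𝕂 : Type := RatFunc ℚ

/-- The indeterminate `q ∈ ℚ(q)`. -/
noncomputable def qq : 𝕂 := RatFunc.X

/-- The Cartan matrix attached to an adjacency function: `2` on the diagonal,
`-1` for adjacent vertices, `0` otherwise. -/
def cartanOf {I : Type} [DecidableEq I] (adj : I → I → Bool) (i j : I) : ℤ :=
  if i = j then 2 else if adj i j then -1 else 0

/-- The datum of a simply laced (ADE) Dynkin diagram of a simple Lie algebra:
a finite nonempty vertex set with a symmetric irreflexive adjacency relation,
connected (simple `𝔤`), whose Cartan matrix is positive definite (finite type;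
together with simply-lacedness this characterizes types A, D, E). -/
structure ADEData (I : Type) [Fintype I] [DecidableEq I] : Type where
  nonE : Nonempty I
  adj : I → I → Bool
  symm : ∀ i j, adj i j = adj j i
  irrefl : ∀ i, adj i i = false
  conn : ∀ i j : I, Relation.ReflTransGen (fun a b => adj a b = true) i j
  posdef : ∀ v : I → ℚ, v ≠ 0 → 0 < ∑ i, ∑ j, (cartanOf adj i j : ℚ) * v i * v j

variable {I : Type} [Fintype I] [DecidableEq I]

/-- Generators `E i`, `F i`, `K i`, `K i⁻¹` of `U_q(𝔤)`. -/
inductive Gen (I : Type) : Type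
  | E : I → Gen I
  | F : I → Gen I
  | K : I → Gen I
  | Kinv : I → Gen I

/-- The free `ℚ(q)`-algebra on the generators. -/
abbrev FA (I : Type) := FreeAlgebra 𝕂 (Gen I)

def gE (i : I) : FA I := FreeAlgebra.ι 𝕂 (Gen.E i)
def gF (i : I) : FA I := FreeAlgebra.ι 𝕂 (Gen.F i)
def gK (i : I) : FA I := FreeAlgebra.ι 𝕂 (Gen.K i)
def gKinv (i : I) : FA I := FreeAlgebra.ι 𝕂 (Gen.Kinv i)

/-- The defining relations of `U_q(𝔤)` (type ADE). -/
inductive QRel (D : ADEData I) : FA I → FA I → Prop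
  | KKinv (i : I) : QRel D (gK i * gKinv i) 1
  | KinvK (i : I) : QRel D (gKinv i * gK i) 1
  | KcommK (i j : I) : QRel D (gK i * gK j) (gK j * gK i)
  | KEself (i : I) : QRel D (gK i * gE i * gKinv i) ((qq ^ 2) • gE i)
  | KFself (i : I) : QRel D (gK i * gF i * gKinv i) ((qq ^ 2)⁻¹ • gF i)
  | EFdiff (i j : I) (h : i ≠ j) : QRel D (gE i * gF j - gF j * gE i) 0
  | EFself (i : I) :
      QRel D (gE i * gF i - gF i * gE i) ((qq - qq⁻¹)⁻¹ • (gK i - gKinv i))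
  | serreE (i j : I) (h : D.adj i j = true) :
      QRel D (gE i ^ 2 * gE j + gE j * gE i ^ 2) ((qq + qq⁻¹) • (gE i * gE j * gE i))
  | serreF (i j : I) (h : D.adj i j = true) :
      QRel D (gF i ^ 2 * gF j + gF j * gF i ^ 2) ((qq + qq⁻¹) • (gF i * gF j * gF i))
  | KEadj (i j : I) (h : D.adj i j = true) :
      QRel D (gK i * gE j * gKinv i) (qq⁻¹ • gE j)
  | KFadj (i j : I) (h : D.adj i j = true) :
      QRel D (gK i * gF j * gKinv i) (qq • gF j)
  | EEfar (i j : I) (h : i ≠ j) (h' : D.adj i j = false) :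
      QRel D (gE i * gE j) (gE j * gE i)
  | FFfar (i j : I) (h : i ≠ j) (h' : D.adj i j = false) :
      QRel D (gF i * gF j) (gF j * gF i)
  | KEfar (i j : I) (h : i ≠ j) (h' : D.adj i j = false) :
      QRel D (gK i * gE j * gKinv i) (gE j)
  | KFfar (i j : I) (h : i ≠ j) (h' : D.adj i j = false) :
      QRel D (gK i * gF j * gKinv i) (gF j)

/-- The quantized universal enveloping algebra `U_q(𝔤)`. -/
abbrev Uq (D : ADEData I) := RingQuot (QRel D)

/-- The generator `E i` of `U_q(𝔤)`. -/
def EE (D : ADEData I) (i : I) : Uq D := RingQuot.mkAlgHom 𝕂 (QRel D) (gE i)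
/-- The generator `F i` of `U_q(𝔤)`. -/
def FF (D : ADEData I) (i : I) : Uq D := RingQuot.mkAlgHom 𝕂 (QRel D) (gF i)
/-- The generator `K i` of `U_q(𝔤)`. -/
def KK (D : ADEData I) (i : I) : Uq D := RingQuot.mkAlgHom 𝕂 (QRel D) (gK i)
/-- The generator `K i ⁻¹` of `U_q(𝔤)`. -/
def KKinv (D : ADEData I) (i : I) : Uq D := RingQuot.mkAlgHom 𝕂 (QRel D) (gKinv i)

/-- The quantum integer `[n] = q^{n-1} + q^{n-3} + ⋯ + q^{-n+1}`. -/
def qInt (n : ℕ) : 𝕂 := ∑ t ∈ Finset.range n, qq ^ ((n : ℤ) - 1 - 2 * (t : ℤ))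

/-- The quantum factorial `[n]! = [n][n-1]⋯[2][1]`. -/
def qFact (n : ℕ) : 𝕂 := ∏ t ∈ Finset.range n, qInt (t + 1)

/-- The `q`-divided power `X^{(n)} = X^n / [n]!`. -/
def dp {D : ADEData I} (x : Uq D) (n : ℕ) : Uq D := (qFact n)⁻¹ • x ^ n

/-- `U_q^-(𝔤)`: the subalgebra generated by the `F i`. -/
def Uminus (D : ADEData I) : Subalgebra 𝕂 (Uq D) :=
  Algebra.adjoin 𝕂 (Set.range (FF D))

/-- `U_q^{≥0}(𝔤)`: the subalgebra generated by the `E i` and `K i^{±1}`. -/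
def Ugeq0 (D : ADEData I) : Subalgebra 𝕂 (Uq D) :=
  Algebra.adjoin 𝕂 (Set.range (EE D) ∪ Set.range (KK D) ∪ Set.range (KKinv D))

/-- A family of algebra automorphisms `T i` is the family of Lusztig braid
automorphisms if it takes the prescribed values on all generators. -/
def IsLusztigAuts (D : ADEData I) (T : I → (Uq D ≃ₐ[𝕂] Uq D)) : Prop :=
  ∀ i j : I,
    (T i (FF D i) = -(KKinv D i * EE D i)) ∧
    (D.adj i j = true → T i (FF D j) = FF D j * FF D i - qq • (FF D i * FF D j)) ∧
    (i ≠ j → D.adj i j = false → T i (FF D j) = FF D j) ∧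
    (T i (EE D i) = -(FF D i * KK D i)) ∧
    (D.adj i j = true → T i (EE D j) = EE D i * EE D j - qq⁻¹ • (EE D j * EE D i)) ∧
    (i ≠ j → D.adj i j = false → T i (EE D j) = EE D j) ∧
    (T i (KK D i) = KKinv D i) ∧
    (D.adj i j = true → T i (KK D j) = KK D i * KK D j) ∧
    (i ≠ j → D.adj i j = false → T i (KK D j) = KK D j)

/-- The Cartan matrix of the diagram. -/
def cartan (D : ADEData I) : I → I → ℤ := cartanOf D.adj

/-- The simple root `α i`, as a vector in the root lattice `ℤ^I`. -/
def simpleRoot (i : I) : I → ℤ := fun j => if j = i then 1 else 0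

/-- The standard pairing `(v, α i)` on the root lattice. -/
def pairing (D : ADEData I) (v : I → ℤ) (i : I) : ℤ := ∑ j, v j * cartan D j i

/-- The simple reflection `s i` acting on the root lattice. -/
def sref (D : ADEData I) (i : I) (v : I → ℤ) : I → ℤ :=
  fun j => v j - pairing D v i * simpleRoot i j

/-- Action of a word `(i₁, …, i_N)` on the root lattice: `s_{i₁} ∘ ⋯ ∘ s_{i_N}`. -/
def wordAct (D : ADEData I) : List I → (I → ℤ) → (I → ℤ)
  | [] => fun v => v
  | i :: l => fun v => sref D i (wordAct D l v)

/-- A word in the generators of the Weyl group is reduced if no shorter word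
defines the same element (i.e., the same action on the root lattice). -/
def IsReducedWord (D : ADEData I) (w : List I) : Prop :=
  ∀ w' : List I, wordAct D w' = wordAct D w → w.length ≤ w'.length

/-- `w` is a reduced expression of the longest element `w₀` of the Weyl group. -/
def IsRedW0 (D : ADEData I) (w : List I) : Prop :=
  IsReducedWord D w ∧ ∀ w' : List I, IsReducedWord D w' → w'.length ≤ w.length

/-- The root `β_k = s_{i₁} ⋯ s_{i_{k-1}} (α_{i_k})` attached to the `k`-th letter
of the word `w` (here `k` is 0-indexed). -/
def beta (D : ADEData I) (w : List I) (k : Fin w.length) : I → ℤ :=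
  wordAct D (w.take k) (simpleRoot (w.get k))

/-- `v` is a root: it lies in the Weyl group orbit of a simple root. -/
def IsRoot (D : ADEData I) (v : I → ℤ) : Prop :=
  ∃ (l : List I) (i : I), v = wordAct D l (simpleRoot i)

/-- `v` is a positive root. -/
def IsPosRoot (D : ADEData I) (v : I → ℤ) : Prop :=
  IsRoot D v ∧ ∀ j, 0 ≤ v j

/-- Apply `T_{i₁} ∘ T_{i₂} ∘ ⋯ ∘ T_{i_m}` for a word `(i₁, …, i_m)`. -/
def applyT {D : ADEData I} (T : I → (Uq D ≃ₐ[𝕂] Uq D)) : List I → Uq D → Uq D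
  | [], x => x
  | i :: l, x => T i (applyT T l x)

/-- Apply `T_{i_m}^{-1} ∘ ⋯ ∘ T_{i₁}^{-1}` for a word `(i₁, …, i_m)`. -/
def applyTinv {D : ADEData I} (T : I → (Uq D ≃ₐ[𝕂] Uq D)) : List I → Uq D → Uq D
  | [], x => x
  | i :: l, x => applyTinv T l ((T i).symm x)

/-- The PBW root vector `F_{i;β_k} = T_{i₁} ⋯ T_{i_{k-1}} (F_{i_k})`
(`k` is 0-indexed). -/
def rootVec {D : ADEData I} (T : I → (Uq D ≃ₐ[𝕂] Uq D)) (w : List I)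
    (k : Fin w.length) : Uq D :=
  applyT T (w.take k) (FF D (w.get k))

/-- The PBW monomial `F^a = F_{β₁}^{(a₁)} F_{β₂}^{(a₂)} ⋯ F_{β_N}^{(a_N)}`
attached to the Lusztig datum `a`. -/
def pbw {D : ADEData I} (T : I → (Uq D ≃ₐ[𝕂] Uq D)) (w : List I)
    (a : Fin w.length → ℕ) : Uq D :=
  ((List.finRange w.length).map (fun k => dp (rootVec T w k) (a k))).prod

/-- `u` is a homogeneous element of weight `μ` for the root-lattice grading of
`U_q(𝔤)`: conjugation by `K i` multiplies it by `q^{(μ, α_i)}`. -/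
def HasWeight (D : ADEData I) (u : Uq D) (μ : I → ℤ) : Prop :=
  ∀ i, KK D i * u * KKinv D i = (qq ^ pairing D μ i) • u

/-- The weight `Σ_k a_k β_k` of a Lusztig datum. -/
def wtData (D : ADEData I) (w : List I) (a : Fin w.length → ℕ) : I → ℤ :=
  ∑ k, (a k : ℤ) • beta D w k

/-- `a` is less than `b` in the left lexicographic order on Lusztig data:
at the first index where they differ, `a` is **bigger**. -/
def LtLeft {N : ℕ} (a b : Fin N → ℕ) : Prop :=
  ∃ k, b k < a k ∧ ∀ l, l < k → a l = b l

/-- `a` is less than `b` in the right lexicographic order on Lusztig data: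
at the last index where they differ, `a` is **bigger**. -/
def LtRight {N : ℕ} (a b : Fin N → ℕ) : Prop :=
  ∃ k, b k < a k ∧ ∀ l, k < l → a l = b l

/-- The partial order `≺` on Lusztig data: same weight, and strictly smaller in
both lexicographic orders. -/
def Prec (D : ADEData I) (w : List I) (a b : Fin w.length → ℕ) : Prop :=
  wtData D w a = wtData D w b ∧ LtLeft a b ∧ LtRight a b

/-- Two words are related by a single braid move. -/
def BraidMove (D : ADEData I) (w w' : List I) : Prop :=
  (∃ (w₁ w₂ : List I) (a b : I), a ≠ b ∧ D.adj a b = false ∧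
      w = w₁ ++ a :: b :: w₂ ∧ w' = w₁ ++ b :: a :: w₂) ∨
  (∃ (w₁ w₂ : List I) (a b : I), D.adj a b = true ∧
      w = w₁ ++ a :: b :: a :: w₂ ∧ w' = w₁ ++ b :: a :: b :: w₂)

instance : Algebra (Polynomial ℤ) 𝕂 :=
  ((Polynomial.aeval qq : Polynomial ℤ →ₐ[ℤ] 𝕂)).toRingHom.toAlgebra

instance (D : ADEData I) : Module (Polynomial ℤ) (Uq D) :=
  Module.compHom _ (algebraMap (Polynomial ℤ) 𝕂)

/-- The `ℤ[q]`-lattice `𝓛` spanned by the PBW monomials of `B_i`. -/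
def latt {D : ADEData I} (T : I → (Uq D ≃ₐ[𝕂] Uq D)) (w : List I) :
    Submodule (Polynomial ℤ) (Uq D) :=
  Submodule.span (Polynomial ℤ) (Set.range (pbw T w))

/-- The sublattice `q𝓛`. -/
def qlatt {D : ADEData I} (T : I → (Uq D ≃ₐ[𝕂] Uq D)) (w : List I) :
    Submodule (Polynomial ℤ) (Uq D) :=
  Submodule.span (Polynomial ℤ) ((fun x => qq • x) '' ((latt T w : Submodule (Polynomial ℤ) (Uq D)) : Set (Uq D)))

/-- `bar` is the bar involution: the `ℚ`-algebra involution fixing `E i` and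
`F i`, sending `K i` to `K i⁻¹` and `q` to `q⁻¹`. -/
def IsBar (D : ADEData I) (bar : Uq D →+* Uq D) : Prop :=
  (∀ i, bar (EE D i) = EE D i) ∧ (∀ i, bar (FF D i) = FF D i) ∧
  (∀ i, bar (KK D i) = KKinv D i) ∧
  bar (algebraMap 𝕂 (Uq D) qq) = algebraMap 𝕂 (Uq D) qq⁻¹ ∧
  ∀ x, bar (bar x) = x

/-- `c ∈ ℚ(q)` is a Laurent polynomial in `q`. -/
def IsLaurent (c : 𝕂) : Prop :=
  ∃ (f : Polynomial ℚ) (m : ℕ), c = qq⁻¹ ^ m * Polynomial.aeval qq f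

/-- `b` is (an indexing of) the canonical basis: it lies in the lattice `𝓛`,
its residues mod `q𝓛` are the residues of the PBW monomials, and it is
bar-invariant. -/
def IsCanBasis {D : ADEData I} (T : I → (Uq D ≃ₐ[𝕂] Uq D)) (w : List I)
    (bar : Uq D →+* Uq D) (b : (Fin w.length → ℕ) → Uq D) : Prop :=
  (∀ a, b a ∈ latt T w) ∧ (∀ a, b a - pbw T w a ∈ qlatt T w) ∧ (∀ a, bar (b a) = b a)

/-- The braid move from `w` to `w'` does not change the relative position of the
roots `u` and `v` in the enumerations of positive roots attached to `w`, `w'`. -/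
def SameRelPos (D : ADEData I) (w w' : List I) (u v : I → ℤ) : Prop :=
  ∀ (k l : Fin w.length) (k' l' : Fin w'.length),
    beta D w k = u → beta D w l = v → beta D w' k' = u → beta D w' l' = v →
    ((k : ℕ) < (l : ℕ) ↔ (k' : ℕ) < (l' : ℕ))

/-- The subring `ℚ[q]₀ ⊆ ℚ(q)` of rational functions regular at `q = 0`. -/
def Reg0 : Subring 𝕂 where
  carrier := {x | ∃ f g : Polynomial ℚ, Polynomial.eval 0 g ≠ 0 ∧
    x * algebraMap (Polynomial ℚ) 𝕂 g = algebraMap (Polynomial ℚ) 𝕂 f}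
  zero_mem' := ⟨0, 1, by simp, by simp⟩
  one_mem' := ⟨1, 1, by simp, by simp⟩
  add_mem' := by
    rintro x y ⟨f1, g1, h1, e1⟩ ⟨f2, g2, h2, e2⟩
    refine ⟨f1 * g2 + f2 * g1, g1 * g2, by simpa using mul_ne_zero h1 h2, ?_⟩
    rw [map_mul, map_add, map_mul, map_mul, ← e1, ← e2]; ring
  mul_mem' := by
    rintro x y ⟨f1, g1, h1, e1⟩ ⟨f2, g2, h2, e2⟩
    refine ⟨f1 * f2, g1 * g2, by simpa using mul_ne_zero h1 h2, ?_⟩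
    rw [map_mul, map_mul, ← e1, ← e2]; ring
  neg_mem' := by
    rintro x ⟨f, g, h, e⟩
    exact ⟨-f, g, h, by rw [map_neg, ← e]; ring⟩

instance (D : ADEData I) : Module ↥Reg0 (Uq D) :=
  Module.compHom _ (Reg0.subtype)

/-- Iterated application of a family of operators along a word. -/
def applyOps {D : ADEData I} (Ft : I → Uq D → Uq D) : List I → Uq D → Uq D
  | [], x => x
  | i :: l, x => Ft i (applyOps Ft l x)

/-- Kashiwara's lattice `𝓛(∞)`: the `ℚ[q]₀`-span of all elements obtained from
`1` by applying sequences of the Kashiwara operators. -/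
def lattInf {D : ADEData I} (Ft : I → Uq D → Uq D) : Submodule ↥Reg0 (Uq D) :=
  Submodule.span ↥Reg0 {x : Uq D | ∃ l : List I, x = applyOps Ft l 1}

/-- The sublattice `q𝓛(∞)`. -/
def qlattInf {D : ADEData I} (Ft : I → Uq D → Uq D) : Submodule ↥Reg0 (Uq D) :=
  Submodule.span ↥Reg0 ((fun x => qq • x) '' ((lattInf Ft : Submodule ↥Reg0 (Uq D)) : Set (Uq D)))

end

set_option linter.unusedSectionVars false
set_option linter.unusedSimpArgs false

section CMcomb

variable {I : Type} [Fintype I] [DecidableEq I] (D : ADEData I)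

def cmB (v w : I → ℤ) : ℤ := ∑ i, pairing D v i * w i

def cmPos (v : I → ℤ) : Prop := ∀ j, 0 ≤ v j

theorem cm_cartan_symm (i j : I) : cartan D i j = cartan D j i := by
  unfold cartan cartanOf
  by_cases h : i = j
  · subst h; rfl
  · rw [if_neg h, if_neg (Ne.symm h), D.symm]

theorem cm_cartan_self (i : I) : cartan D i i = 2 := by simp [cartan, cartanOf]

theorem cm_pairing_add (v w : I → ℤ) (i : I) :
    pairing D (v + w) i = pairing D v i + pairing D w i := by
  simp [pairing, add_mul, Finset.sum_add_distrib]

theorem cm_pairing_smul (c : ℤ) (v : I → ℤ) (i : I) :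
    pairing D (c • v) i = c * pairing D v i := by
  simp [pairing, Finset.mul_sum, mul_assoc]

theorem cm_pairing_neg (v : I → ℤ) (i : I) :
    pairing D (-v) i = - pairing D v i := by
  simp [pairing]

theorem cm_pairing_simple (k i : I) : pairing D (simpleRoot k) i = cartan D k i := by
  simp [pairing, simpleRoot]

theorem cmB_symm (v w : I → ℤ) : cmB D v w = cmB D w v := by
  simp only [cmB, pairing, Finset.sum_mul]
  rw [Finset.sum_comm]
  refine Finset.sum_congr rfl fun i _ => Finset.sum_congr rfl fun j _ => ?_
  rw [cm_cartan_symm]; ring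

theorem cmB_add_left (u v w : I → ℤ) : cmB D (u + v) w = cmB D u w + cmB D v w := by
  simp [cmB, cm_pairing_add, add_mul, Finset.sum_add_distrib]

theorem cmB_smul_left (c : ℤ) (v w : I → ℤ) : cmB D (c • v) w = c * cmB D v w := by
  simp only [cmB, cm_pairing_smul, Finset.mul_sum, mul_assoc]

theorem cmB_add_right (u v w : I → ℤ) : cmB D w (u + v) = cmB D w u + cmB D w v := by
  rw [cmB_symm, cmB_add_left, cmB_symm D u, cmB_symm D v]

theorem cmB_smul_right (c : ℤ) (v w : I → ℤ) : cmB D w (c • v) = c * cmB D w v := by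
  rw [cmB_symm, cmB_smul_left, cmB_symm D v]

theorem cmB_simple (v : I → ℤ) (i : I) : cmB D v (simpleRoot i) = pairing D v i := by
  simp [cmB, simpleRoot]

theorem cm_sref_eq (i : I) (v : I → ℤ) :
    sref D i v = v + (-(pairing D v i)) • simpleRoot i := by
  funext j; simp [sref, sub_eq_add_neg]

theorem cmB_sref (i : I) (v : I → ℤ) : cmB D (sref D i v) (sref D i v) = cmB D v v := by
  rw [cm_sref_eq]
  simp only [cmB_add_left, cmB_add_right, cmB_smul_left, cmB_smul_right, cmB_simple,
    cm_pairing_add, cm_pairing_smul, cmB_symm D (simpleRoot i) v, cm_pairing_simple, cm_cartan_self]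
  ring

theorem cm_sref_add (i : I) (v w : I → ℤ) : sref D i (v + w) = sref D i v + sref D i w := by
  simp only [cm_sref_eq, cm_pairing_add]; module

theorem cm_sref_neg (i : I) (v : I → ℤ) : sref D i (-v) = - sref D i v := by
  simp only [cm_sref_eq, cm_pairing_neg]; module

theorem cm_sref_smul (i : I) (c : ℤ) (v : I → ℤ) : sref D i (c • v) = c • sref D i v := by
  simp only [cm_sref_eq, cm_pairing_smul]; module

theorem cm_sref_self (i : I) : sref D i (simpleRoot i) = - simpleRoot i := by
  simp only [cm_sref_eq, cm_pairing_simple, cm_cartan_self]; module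

theorem cm_sref_sref (i : I) (v : I → ℤ) : sref D i (sref D i v) = v := by
  rw [cm_sref_eq D i v, cm_sref_add, cm_sref_smul, cm_sref_self, cm_sref_eq]; module

theorem cm_sref_adj {i j : I} (h : D.adj i j = true) :
    sref D i (simpleRoot j) = simpleRoot i + simpleRoot j := by
  have hne : j ≠ i := by rintro rfl; rw [D.irrefl] at h; cases h
  have : cartan D j i = -1 := by
    simp [cartan, cartanOf, hne, D.symm j i, h]
  simp only [cm_sref_eq, cm_pairing_simple, this]; module

theorem cm_sref_far {i j : I} (hne : i ≠ j) (h : D.adj i j = false) :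
    sref D i (simpleRoot j) = simpleRoot j := by
  have : cartan D j i = 0 := by
    simp [cartan, cartanOf, hne.symm, D.symm j i, h]
  simp only [cm_sref_eq, cm_pairing_simple, this]; module

/-! word action -/

theorem cm_wa_append (u v : List I) (x : I → ℤ) :
    wordAct D (u ++ v) x = wordAct D u (wordAct D v x) := by
  induction u with
  | nil => rfl
  | cons a u ih => simp [wordAct, ih]

theorem cm_wa_add (u : List I) (x y : I → ℤ) :
    wordAct D u (x + y) = wordAct D u x + wordAct D u y := by
  induction u with
  | nil => rfl
  | cons a u ih => simp [wordAct, ih, cm_sref_add]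

theorem cm_wa_neg (u : List I) (x : I → ℤ) :
    wordAct D u (-x) = - wordAct D u x := by
  induction u with
  | nil => rfl
  | cons a u ih => simp [wordAct, ih, cm_sref_neg]

theorem cm_wa_smul (u : List I) (c : ℤ) (x : I → ℤ) :
    wordAct D u (c • x) = c • wordAct D u x := by
  induction u with
  | nil => rfl
  | cons a u ih => simp only [wordAct, ih, cm_sref_smul]

theorem cm_wa_rev (u : List I) (x : I → ℤ) : wordAct D u.reverse (wordAct D u x) = x := by
  induction u generalizing x with
  | nil => rfl
  | cons a u ih => simp [wordAct, cm_wa_append, cm_sref_sref, ih]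

theorem cm_wa_rev2 (u : List I) (x : I → ℤ) : wordAct D u (wordAct D u.reverse x) = x := by
  have := cm_wa_rev D u.reverse x
  rwa [List.reverse_reverse] at this

theorem cm_wa_rev_congr {u v : List I} (h : wordAct D u = wordAct D v) :
    wordAct D u.reverse = wordAct D v.reverse := by
  funext x
  have h1 := cm_wa_rev D u (wordAct D v.reverse x)
  rw [h, cm_wa_rev2] at h1
  exact h1

theorem cm_wa_cons_congr (a : I) {u v : List I} (h : wordAct D u = wordAct D v) :
    wordAct D (a :: u) = wordAct D (a :: v) := by
  funext x; simp [wordAct, h]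

theorem cm_wa_cons_cancel (a : I) {u v : List I} (h : wordAct D (a :: u) = wordAct D (a :: v)) :
    wordAct D u = wordAct D v := by
  funext x
  have := congrArg (sref D a) (congrFun h x)
  simpa [wordAct, cm_sref_sref] using this

theorem cmB_wa (u : List I) (x : I → ℤ) :
    cmB D (wordAct D u x) (wordAct D u x) = cmB D x x := by
  induction u with
  | nil => rfl
  | cons a u ih => simp [wordAct, ih, cmB_sref]

def cmRt (v : I → ℤ) : Prop := cmB D v v = 2

theorem cm_rt_wa (u : List I) (i : I) : cmRt D (wordAct D u (simpleRoot i)) := by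
  unfold cmRt
  rw [cmB_wa, cmB_simple, cm_pairing_simple, cm_cartan_self]

theorem cm_rt_simple (i : I) : cmRt D (simpleRoot i) := cm_rt_wa D [] i

theorem cm_even (v : I → ℤ) : Even (cmB D v v) := by
  rw [even_iff_two_dvd]
  refine (ZMod.intCast_zmod_eq_zero_iff_dvd _ 2).1 ?_
  simp only [cmB, pairing, Finset.sum_mul, Int.cast_sum]
  rw [← Finset.sum_product']
  refine Finset.sum_involution (fun a _ => (a.2, a.1)) ?_ ?_ ?_ ?_
  · rintro ⟨a, b⟩ -
    simp only
    rw [cm_cartan_symm D a b, show v a * cartan D b a * v b = v b * cartan D b a * v a by ring]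
    exact CharTwo.add_self_eq_zero _
  · rintro ⟨a, b⟩ - h h2
    simp only [Prod.mk.injEq] at h2
    obtain ⟨rfl, -⟩ := h2
    apply h
    simp only [cm_cartan_self]
    push_cast
    rw [show (2 : ZMod 2) = 0 from rfl]; ring
  · intros; simp
  · intros; rfl

theorem cm_posdef (v : I → ℤ) (hv : v ≠ 0) : 0 < cmB D v v := by
  have h := D.posdef (fun i => (v i : ℚ)) (by
    intro h; apply hv; funext i
    have := congrFun h i
    simpa using this)
  have e : (cmB D v v : ℚ) = ∑ i, ∑ j, (cartanOf D.adj i j : ℚ) * v i * v j := by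
    simp only [cmB, pairing, Finset.sum_mul, cartan]
    push_cast
    rw [Finset.sum_comm]
    refine Finset.sum_congr rfl fun i _ => Finset.sum_congr rfl fun j _ => ?_
    ring
  rw [← e] at h
  exact_mod_cast h

theorem cm_two_le (v : I → ℤ) (hv : v ≠ 0) : 2 ≤ cmB D v v := by
  have h1 := cm_posdef D v hv
  obtain ⟨k, hk⟩ := cm_even D v
  omega

theorem cm_rt_ne {v : I → ℤ} (h : cmRt D v) : v ≠ 0 := by
  rintro rfl
  simp [cmRt, cmB] at h

theorem cm_dich {v : I → ℤ} (h : cmRt D v) : cmPos v ∨ cmPos (-v) := by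
  set p : I → ℤ := fun i => max (v i) 0 with hp
  set n : I → ℤ := fun i => max (-v i) 0 with hn
  have e : v = p + (-1 : ℤ) • n := by
    funext i; simp only [hp, hn, Pi.add_apply, Pi.smul_apply, smul_eq_mul]; omega
  have hle : cmB D p n ≤ 0 := by
    simp only [cmB, pairing, Finset.sum_mul]
    refine Finset.sum_nonpos fun i _ => Finset.sum_nonpos fun j _ => ?_
    by_cases hij : j = i
    · subst hij
      have : p j = 0 ∨ n j = 0 := by simp only [hp, hn]; omega
      rcases this with h0 | h0 <;> simp [h0]
    · have h1 : 0 ≤ p j := le_max_right _ _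
      have h2 : 0 ≤ n i := le_max_right _ _
      have h3 : cartan D j i ≤ 0 := by
        unfold cartan cartanOf; rw [if_neg hij]; split_ifs <;> simp
      exact mul_nonpos_of_nonpos_of_nonneg (mul_nonpos_of_nonneg_of_nonpos h1 h3) h2
  have hq : cmB D v v = cmB D p p + cmB D n n - 2 * cmB D p n := by
    conv_lhs => rw [e]
    simp only [cmB_add_left, cmB_add_right, cmB_smul_left, cmB_smul_right, cmB_symm D n p]
    ring
  unfold cmRt at h
  by_cases hp0 : p = 0
  · right; intro i
    have := congrFun hp0 i
    simp only [hp, Pi.zero_apply] at this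
    simp only [Pi.neg_apply]; omega
  by_cases hn0 : n = 0
  · left; intro i
    have := congrFun hn0 i
    simp only [hn, Pi.zero_apply] at this
    omega
  have := cm_two_le D p hp0
  have := cm_two_le D n hn0
  omega

theorem cm_not_both {v : I → ℤ} (h : cmRt D v) (h1 : cmPos v) (h2 : cmPos (-v)) : False := by
  apply cm_rt_ne D h
  funext i
  have a := h1 i
  have b := h2 i
  simp only [Pi.neg_apply] at b
  simp only [Pi.zero_apply]; omega

theorem cm_simple_pos (i : I) : cmPos (simpleRoot i) := by
  intro j; unfold simpleRoot; split_ifs <;> simp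

/-- positive root with `s_i v` negative is `α_i` -/
theorem cm_eq_simple {v : I → ℤ} (h : cmRt D v) (hp : cmPos v) (i : I)
    (hn : cmPos (-(sref D i v))) : v = simpleRoot i := by
  have h0 : ∀ j, j ≠ i → v j = 0 := by
    intro j hj
    have a := hp j
    have b := hn j
    simp [sref, simpleRoot, hj] at b
    omega
  have e : v = v i • simpleRoot i := by
    funext j
    by_cases hj : j = i
    · subst hj; simp [simpleRoot]
    · simp [simpleRoot, hj, h0 j hj]
  have h2 : v i * (v i * 2) = 2 := by
    unfold cmRt at h
    rw [e, cmB_smul_left, cmB_smul_right] at h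
    rwa [cmB_simple, cm_pairing_simple, cm_cartan_self] at h
  have h3 : v i = 1 := by
    have := hp i
    nlinarith
  rw [e, h3, one_smul]

theorem cm_sum_not_simple {v w : I → ℤ} (hv : cmRt D v) (hw : cmRt D w) (pv : cmPos v)
    (pw : cmPos w) (i : I) (h : v + w = simpleRoot i) : False := by
  have hh : ∀ j, v j + w j = if j = i then 1 else 0 := fun j => congrFun h j
  have hi := hh i
  rw [if_pos rfl] at hi
  have : v i = 0 ∨ w i = 0 := by have := pv i; have := pw i; omega
  rcases this with h0 | h0
  · apply cm_rt_ne D hv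
    funext j
    by_cases hj : j = i
    · subst hj; exact h0
    · have := hh j; rw [if_neg hj] at this; have := pv j; have := pw j
      simp only [Pi.zero_apply]; omega
  · apply cm_rt_ne D hw
    funext j
    by_cases hj : j = i
    · subst hj; exact h0
    · have := hh j; rw [if_neg hj] at this; have := pv j; have := pw j
      simp only [Pi.zero_apply]; omega

theorem cm_neg_neg_pos {v : I → ℤ} (h : cmPos v) : cmPos (- -v) := by rwa [neg_neg]

/-- reflection conjugation -/
theorem cm_conj (u : List I) (b c : I) (h : wordAct D u (simpleRoot c) = simpleRoot b) :
    wordAct D (b :: u) = wordAct D (u ++ [c]) := by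
  funext x
  rw [cm_wa_append]
  change sref D b (wordAct D u x) = wordAct D u (sref D c x)
  rw [cm_sref_eq D c, cm_wa_add, cm_wa_smul, h, cm_sref_eq]
  congr 3
  have key : ∀ y z, cmB D (wordAct D u y) (wordAct D u z) = cmB D y z := by
    intro y z
    have h1 := cmB_wa D u (y + z)
    rw [cm_wa_add] at h1
    simp only [cmB_add_left, cmB_add_right, cmB_wa, cmB_symm D (wordAct D u z) (wordAct D u y),
      cmB_symm D z y] at h1
    omega
  rw [← cmB_simple, ← cmB_simple, ← key x, h]

/-- exchange -/
theorem cm_exch (u : List I) (b : I) (h : cmPos (-(wordAct D u.reverse (simpleRoot b)))) :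
    ∃ u' : List I, u'.length + 1 = u.length ∧ wordAct D (b :: u') = wordAct D u := by
  induction u using List.reverseRecOn with
  | nil => exact (cm_not_both D (cm_rt_simple D b) (cm_simple_pos b) h).elim
  | append_singleton u c ih =>
    rw [List.reverse_append] at h
    change cmPos (-(sref D c (wordAct D u.reverse (simpleRoot b)))) at h
    rcases cm_dich D (cm_rt_wa D u.reverse b) with hp | hn
    · have e := cm_eq_simple D (cm_rt_wa D u.reverse b) hp c h
      refine ⟨u, by simp, cm_conj D u b c ?_⟩
      rw [← e, cm_wa_rev2]
    · obtain ⟨u', hl, he⟩ := ih hn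
      refine ⟨u' ++ [c], by simp [hl], ?_⟩
      funext x
      rw [← List.cons_append, cm_wa_append, he, cm_wa_append]

theorem cm_red_congr {u v : List I} (hu : IsReducedWord D u) (h : wordAct D v = wordAct D u)
    (hl : v.length ≤ u.length) : IsReducedWord D v := by
  intro w hw
  exact hl.trans (hu w (hw.trans h))

theorem cm_red_rev {u : List I} (hu : IsReducedWord D u) : IsReducedWord D u.reverse := by
  intro w hw
  have := hu w.reverse (by
    have := cm_wa_rev_congr D hw
    rwa [List.reverse_reverse] at this)
  simpa using this

theorem cm_red_suffix {u v : List I} (hu : IsReducedWord D (u ++ v)) : IsReducedWord D v := by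
  intro w hw
  have := hu (u ++ w) (by funext x; rw [cm_wa_append, cm_wa_append, hw])
  simp at this; exact this

theorem cm_red_prefix {u v : List I} (hu : IsReducedWord D (u ++ v)) : IsReducedWord D u := by
  intro w hw
  have := hu (w ++ v) (by funext x; rw [cm_wa_append, cm_wa_append, hw])
  simp at this; exact this

theorem cm_red_tail {a : I} {u : List I} (hu : IsReducedWord D (a :: u)) : IsReducedWord D u :=
  cm_red_suffix D (u := [a]) hu

theorem cm_red_cons_pos {b : I} {u : List I} (h : IsReducedWord D (b :: u)) :
    cmPos (wordAct D u.reverse (simpleRoot b)) := by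
  rcases cm_dich D (cm_rt_wa D u.reverse b) with hp | hn
  · exact hp
  · obtain ⟨u', hl, he⟩ := cm_exch D u b hn
    have := h u' (by
      funext x
      change _ = sref D b (wordAct D u x)
      rw [← he]; simp [wordAct, cm_sref_sref])
    simp at this; omega

theorem cm_red_snoc_pos {b : I} {u : List I} (h : IsReducedWord D (u ++ [b])) :
    cmPos (wordAct D u (simpleRoot b)) := by
  have h1 := cm_red_rev D h
  rw [List.reverse_append] at h1
  have := cm_red_cons_pos D (b := b) (u := u.reverse) h1
  rwa [List.reverse_reverse] at this

/-- right exchange -/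
theorem cm_exch_right (u : List I) (b : I) (h : cmPos (-(wordAct D u (simpleRoot b)))) :
    ∃ u' : List I, u'.length + 1 = u.length ∧ wordAct D (u' ++ [b]) = wordAct D u := by
  obtain ⟨u', hl, he⟩ := cm_exch D u.reverse b (by rwa [List.reverse_reverse])
  refine ⟨u'.reverse, by simpa using hl, ?_⟩
  have := cm_wa_rev_congr D he
  simpa using this

theorem cm_no_triangle {a b k : I} (h1 : D.adj a b = true) (h2 : D.adj a k = true) :
    D.adj b k = false := by
  by_contra h3
  rw [Bool.not_eq_false] at h3
  have ne : ∀ {x y : I}, D.adj x y = true → x ≠ y := by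
    rintro x y h rfl; rw [D.irrefl] at h; cases h
  have c : ∀ {x y : I}, D.adj x y = true → cartan D x y = -1 := by
    intro x y h; simp [cartan, cartanOf, ne h, h]
  have hv := cm_posdef D (simpleRoot a + simpleRoot b + simpleRoot k) (by
    intro h
    have := congrFun h a
    simp [simpleRoot, ne h1, ne h2] at this)
  simp only [cmB_add_left, cmB_add_right, cmB_simple, cm_pairing_add,
    cm_pairing_simple, cm_cartan_self, c h1,
    c h2, c h3, cm_cartan_symm D b a, cm_cartan_symm D k a, cm_cartan_symm D k b] at hv
  omega

end CMcomb

section CMalg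

variable {k A : Type*} [Field k] [Ring A] [Algebra k A]

theorem cm_R1 (q : k) (hq : q ≠ 0) (hq2 : q - q⁻¹ ≠ 0) (E Fa Fb K L : A)
    (h1 : E * Fb = Fb * E) (h2 : E * Fa - Fa * E = (q - q⁻¹)⁻¹ • (K - L))
    (h3 : K * Fb = q • (Fb * K)) (h4 : L * Fb = q⁻¹ • (Fb * L)) :
    E * (Fb * Fa - q • (Fa * Fb)) - (Fb * Fa - q • (Fa * Fb)) * E = (-q) • (Fb * K) := by
  have e : E * (Fb * Fa - q • (Fa * Fb)) - (Fb * Fa - q • (Fa * Fb)) * E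
      = Fb * (E * Fa - Fa * E) - q • ((E * Fa - Fa * E) * Fb) := by
    have h1' : ∀ z, E * (Fb * z) = Fb * (E * z) := fun z => by
      rw [← mul_assoc, h1, mul_assoc]
    simp only [mul_sub, sub_mul, mul_assoc, smul_mul_assoc, mul_smul_comm, h1, h1', smul_sub]
    abel
  rw [e, h2]
  simp only [mul_sub, sub_mul, smul_mul_assoc, mul_smul_comm, h3, h4, smul_sub]
  have hc : q * ((q - q⁻¹)⁻¹ * q) = (q - q⁻¹)⁻¹ + q := by
    have : (q - q⁻¹)⁻¹ * (q * q - 1) = q := by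
      rw [show q * q - 1 = (q - q⁻¹) * q by field_simp]
      rw [← mul_assoc, inv_mul_cancel₀ hq2, one_mul]
    linear_combination this
  have hd : q * ((q - q⁻¹)⁻¹ * q⁻¹) = (q - q⁻¹)⁻¹ := by
    rw [mul_comm, mul_assoc, inv_mul_cancel₀ hq, mul_one]
  simp only [smul_smul, hc, hd]
  module

theorem cm_XF (q : k) (hq : q ≠ 0) (hq2 : q - q⁻¹ ≠ 0) (E Fa Fb K L : A)
    (h1 : E * Fb = Fb * E) (h2 : E * Fa - Fa * E = (q - q⁻¹)⁻¹ • (K - L))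
    (h3 : K * Fb = q • (Fb * K)) (h4 : L * Fb = q⁻¹ • (Fb * L))
    (h5 : L * Fa = (q ^ 2) • (Fa * L)) (h6 : L * K = 1) :
    -(L * E) * (Fb * Fa - q • (Fa * Fb)) - q • ((Fb * Fa - q • (Fa * Fb)) * -(L * E)) = Fb := by
  have R := cm_R1 q hq hq2 E Fa Fb K L h1 h2 h3 h4
  set P := Fb * Fa - q • (Fa * Fb) with hP
  have hLP : L * P = q • (P * L) := by
    have h4' : ∀ z, L * (Fb * z) = q⁻¹ • (Fb * (L * z)) := fun z => by
      rw [← mul_assoc, h4, smul_mul_assoc, mul_assoc]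
    have h5' : ∀ z, L * (Fa * z) = (q ^ 2) • (Fa * (L * z)) := fun z => by
      rw [← mul_assoc, h5, smul_mul_assoc, mul_assoc]
    simp only [hP, mul_sub, sub_mul, mul_assoc, smul_mul_assoc, mul_smul_comm, h4, h4', h5, h5',
      smul_sub, smul_smul]
    congr 2 <;> field_simp
  clear_value P
  have e : -(L * E) * P - q • (P * -(L * E)) = -(L * (E * P - P * E)) := by
    have : q • (P * -(L * E)) = -(L * (P * E)) := by
      rw [mul_neg, ← mul_assoc, smul_neg, ← smul_mul_assoc, ← hLP, mul_assoc]
    rw [this, mul_sub, neg_mul, mul_assoc]; abel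
  rw [e, R, mul_smul_comm, ← mul_assoc, h4, smul_mul_assoc, mul_assoc, h6, mul_one, smul_smul,
    ← neg_smul, neg_mul, neg_neg, mul_inv_cancel₀ hq, one_smul]

theorem cm_XE (q : k) (hq : q ≠ 0) (hq2 : q - q⁻¹ ≠ 0) (Ea Eb F K L : A)
    (h1 : Eb * F = F * Eb) (h2 : Ea * F - F * Ea = (q - q⁻¹)⁻¹ • (K - L))
    (h3 : K * Eb = q⁻¹ • (Eb * K)) (h4 : L * Eb = q • (Eb * L))
    (h5 : K * Ea = (q ^ 2) • (Ea * K)) (h6 : L * K = 1) :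
    (Ea * Eb - q⁻¹ • (Eb * Ea)) * -(F * K) - q⁻¹ • (-(F * K) * (Ea * Eb - q⁻¹ • (Eb * Ea)))
      = Eb := by
  set X := Ea * Eb - q⁻¹ • (Eb * Ea) with hX
  have hKX : K * X = q • (X * K) := by
    have h3' : ∀ z, K * (Eb * z) = q⁻¹ • (Eb * (K * z)) := fun z => by
      rw [← mul_assoc, h3, smul_mul_assoc, mul_assoc]
    have h5' : ∀ z, K * (Ea * z) = (q ^ 2) • (Ea * (K * z)) := fun z => by
      rw [← mul_assoc, h5, smul_mul_assoc, mul_assoc]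
    simp only [hX, mul_sub, sub_mul, mul_assoc, smul_mul_assoc, mul_smul_comm, h3, h3', h5, h5',
      smul_sub, smul_smul]
    congr 2 <;> field_simp
  have R : X * F - F * X = -(Eb * L) := by
    have e : X * F - F * X = (Ea * F - F * Ea) * Eb - q⁻¹ • (Eb * (Ea * F - F * Ea)) := by
      have h1' : ∀ z, Eb * (F * z) = F * (Eb * z) := fun z => by
        rw [← mul_assoc, h1, mul_assoc]
      simp only [hX, mul_sub, sub_mul, mul_assoc, smul_mul_assoc, mul_smul_comm, h1, h1', smul_sub]
      abel
    rw [e, h2]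
    simp only [mul_sub, sub_mul, smul_mul_assoc, mul_smul_comm, h3, h4, smul_sub]
    have hc : (q - q⁻¹)⁻¹ * q = q⁻¹ * (q - q⁻¹)⁻¹ + 1 := by
      have := inv_mul_cancel₀ hq2
      linear_combination this
    simp only [smul_smul, hc]
    module
  clear_value X
  have e : X * -(F * K) - q⁻¹ • (-(F * K) * X) = -((X * F - F * X) * K) := by
    have : q⁻¹ • (-(F * K) * X) = -(F * (X * K)) := by
      rw [neg_mul, mul_assoc, hKX, mul_smul_comm, smul_neg, smul_smul, inv_mul_cancel₀ hq, one_smul]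
    rw [this, mul_neg, sub_mul, mul_assoc, mul_assoc]; abel
  rw [e, R, neg_mul, neg_neg, mul_assoc, h6, mul_one]

theorem cm_Y (q : k) (Fk Fa Fb : A) (h : Fk * Fb = Fb * Fk) :
    (Fk * Fa - q • (Fa * Fk)) * Fb - q • (Fb * (Fk * Fa - q • (Fa * Fk)))
     = Fk * (Fa * Fb - q • (Fb * Fa)) - q • ((Fa * Fb - q • (Fb * Fa)) * Fk) := by
  have h' : ∀ z, Fk * (Fb * z) = Fb * (Fk * z) := fun z => by
    rw [← mul_assoc, h, mul_assoc]
  simp only [mul_sub, sub_mul, mul_assoc, smul_mul_assoc, mul_smul_comm, h, h', smul_sub]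
  abel

theorem cm_YE (q : k) (Fk Fa Fb : A) (h : Fk * Fb = Fb * Fk) :
    Fb * (Fa * Fk - q • (Fk * Fa)) - q • ((Fa * Fk - q • (Fk * Fa)) * Fb)
     = (Fb * Fa - q • (Fa * Fb)) * Fk - q • (Fk * (Fb * Fa - q • (Fa * Fb))) := by
  have h' : ∀ z, Fk * (Fb * z) = Fb * (Fk * z) := fun z => by
    rw [← mul_assoc, h, mul_assoc]
  simp only [mul_sub, sub_mul, mul_assoc, smul_mul_assoc, mul_smul_comm, h, h', smul_sub]
  abel

theorem cm_Z (q : k) (Fk Fa Fb : A) (h : Fa * Fb = Fb * Fa) :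
    (Fk * Fa - q • (Fa * Fk)) * Fb - q • (Fb * (Fk * Fa - q • (Fa * Fk)))
     = (Fk * Fb - q • (Fb * Fk)) * Fa - q • (Fa * (Fk * Fb - q • (Fb * Fk))) := by
  have h' : ∀ z, Fa * (Fb * z) = Fb * (Fa * z) := fun z => by
    rw [← mul_assoc, h, mul_assoc]
  simp only [mul_sub, sub_mul, mul_assoc, smul_mul_assoc, mul_smul_comm, h, h', smul_sub]
  abel

theorem cm_ZE (q : k) (Fk Fa Fb : A) (h : Fa * Fb = Fb * Fa) :
    Fb * (Fa * Fk - q • (Fk * Fa)) - q • ((Fa * Fk - q • (Fk * Fa)) * Fb)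
     = Fa * (Fb * Fk - q • (Fk * Fb)) - q • ((Fb * Fk - q • (Fk * Fb)) * Fa) := by
  have h' : ∀ z, Fa * (Fb * z) = Fb * (Fa * z) := fun z => by
    rw [← mul_assoc, h, mul_assoc]
  simp only [mul_sub, sub_mul, mul_assoc, smul_mul_assoc, mul_smul_comm, h, h', smul_sub]
  abel

/-- From `K x K⁻¹ = c x` to commutation relations. -/
theorem cm_conjK (c : k) (hc : c ≠ 0) (K L x : A) (h2 : L * K = 1)
    (h : K * x * L = c • x) : K * x = c • (x * K) ∧ L * x = c⁻¹ • (x * L) := by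
  have a : K * x = c • (x * K) := by
    rw [← smul_mul_assoc, ← h, mul_assoc, h2, mul_one]
  refine ⟨a, ?_⟩
  have : x * L = c • (L * x) := by
    rw [← mul_smul_comm, ← h, ← mul_assoc, ← mul_assoc, h2, one_mul]
  rw [this, smul_smul, inv_mul_cancel₀ hc, one_smul]

end CMalg

section CMuq

variable {I : Type} [Fintype I] [DecidableEq I] (D : ADEData I)

theorem cm_q0 : qq ≠ 0 := RatFunc.X_ne_zero

theorem cm_q1 : qq - qq⁻¹ ≠ 0 := by
  intro h
  have h1 : qq * qq = 1 := by
    have := congrArg (fun x => x * qq) h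
    simp only [sub_mul, zero_mul, inv_mul_cancel₀ cm_q0] at this
    exact sub_eq_zero.1 this
  have h2 : (Polynomial.X * Polynomial.X : Polynomial ℚ) = 1 := by
    apply RatFunc.algebraMap_injective ℚ
    rw [map_mul, map_one, RatFunc.algebraMap_X]
    exact h1
  have := congrArg (Polynomial.eval 0) h2
  simp at this

theorem cm_KL (i : I) : KK D i * KKinv D i = 1 := by
  simpa [KK, KKinv] using RingQuot.mkAlgHom_rel 𝕂 (QRel.KKinv (D := D) i)

theorem cm_LK (i : I) : KKinv D i * KK D i = 1 := by
  simpa [KK, KKinv] using RingQuot.mkAlgHom_rel 𝕂 (QRel.KinvK (D := D) i)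

theorem cm_KK (i j : I) : KK D i * KK D j = KK D j * KK D i := by
  simpa [KK, KKinv] using RingQuot.mkAlgHom_rel 𝕂 (QRel.KcommK (D := D) i j)

theorem cm_EFdiff {i j : I} (h : i ≠ j) : EE D i * FF D j = FF D j * EE D i := by
  have := RingQuot.mkAlgHom_rel 𝕂 (QRel.EFdiff (D := D) i j h)
  rw [map_sub, map_mul, map_mul, map_zero] at this
  exact sub_eq_zero.1 this

theorem cm_EFself (i : I) : EE D i * FF D i - FF D i * EE D i
    = (qq - qq⁻¹)⁻¹ • (KK D i - KKinv D i) := by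
  have := RingQuot.mkAlgHom_rel 𝕂 (QRel.EFself (D := D) i)
  rw [map_sub, map_mul, map_mul, map_smul, map_sub] at this
  exact this

theorem cm_FFfar {i j : I} (h : i ≠ j) (h' : D.adj i j = false) :
    FF D i * FF D j = FF D j * FF D i := by
  have := RingQuot.mkAlgHom_rel 𝕂 (QRel.FFfar (D := D) i j h h')
  rw [map_mul, map_mul] at this
  exact this

theorem cm_EEfar {i j : I} (h : i ≠ j) (h' : D.adj i j = false) :
    EE D i * EE D j = EE D j * EE D i := by
  have := RingQuot.mkAlgHom_rel 𝕂 (QRel.EEfar (D := D) i j h h')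
  rw [map_mul, map_mul] at this
  exact this

theorem cm_KEself (i : I) : KK D i * EE D i = (qq ^ 2) • (EE D i * KK D i) := by
  have := RingQuot.mkAlgHom_rel 𝕂 (QRel.KEself (D := D) i)
  rw [map_mul, map_mul, map_smul] at this
  exact (cm_conjK _ (pow_ne_zero 2 cm_q0) _ _ _ (cm_LK D i) this).1

theorem cm_KFself (i : I) : KK D i * FF D i = (qq ^ 2)⁻¹ • (FF D i * KK D i)
    ∧ KKinv D i * FF D i = (qq ^ 2) • (FF D i * KKinv D i) := by
  have := RingQuot.mkAlgHom_rel 𝕂 (QRel.KFself (D := D) i)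
  rw [map_mul, map_mul, map_smul] at this
  have h := (cm_conjK _ (inv_ne_zero (pow_ne_zero 2 cm_q0)) _ _ _ (cm_LK D i) this)
  rw [inv_inv] at h
  exact h

theorem cm_KEadj {i j : I} (h : D.adj i j = true) :
    KK D i * EE D j = qq⁻¹ • (EE D j * KK D i)
    ∧ KKinv D i * EE D j = qq • (EE D j * KKinv D i) := by
  have := RingQuot.mkAlgHom_rel 𝕂 (QRel.KEadj (D := D) i j h)
  rw [map_mul, map_mul, map_smul] at this
  have h := (cm_conjK _ (inv_ne_zero cm_q0) _ _ _ (cm_LK D i) this)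
  rw [inv_inv] at h
  exact h

theorem cm_KFadj {i j : I} (h : D.adj i j = true) :
    KK D i * FF D j = qq • (FF D j * KK D i)
    ∧ KKinv D i * FF D j = qq⁻¹ • (FF D j * KKinv D i) := by
  have := RingQuot.mkAlgHom_rel 𝕂 (QRel.KFadj (D := D) i j h)
  rw [map_mul, map_mul, map_smul] at this
  exact cm_conjK _ cm_q0 _ _ _ (cm_LK D i) this

theorem cm_KF (i j : I) : ∃ c : 𝕂, KK D i * FF D j = c • (FF D j * KK D i) := by
  by_cases hij : i = j
  · subst hij; exact ⟨_, (cm_KFself D i).1⟩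
  cases h : D.adj i j with
  | true => exact ⟨_, (cm_KFadj D h).1⟩
  | false =>
    have := RingQuot.mkAlgHom_rel 𝕂 (QRel.KFfar (D := D) i j hij h)
    rw [map_mul, map_mul] at this
    have h2 : KK D i * FF D j * KKinv D i = (1 : 𝕂) • FF D j := by rw [one_smul]; exact this
    exact ⟨_, (cm_conjK _ one_ne_zero _ _ _ (cm_LK D i) h2).1⟩

theorem cm_FF_mem (i : I) : FF D i ∈ Uminus D := Algebra.subset_adjoin ⟨i, rfl⟩

theorem cm_KU (i : I) {y : Uq D} (hy : y ∈ Uminus D) :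
    ∃ y' ∈ Uminus D, KK D i * y = y' * KK D i := by
  unfold Uminus at hy
  induction hy using Algebra.adjoin_induction with
  | mem x hx =>
    obtain ⟨j, rfl⟩ := hx
    obtain ⟨c, hc⟩ := cm_KF D i j
    exact ⟨c • FF D j, Subalgebra.smul_mem _ (cm_FF_mem D j) _, by rw [hc, smul_mul_assoc]⟩
  | algebraMap r =>
    exact ⟨algebraMap _ _ r, Subalgebra.algebraMap_mem _ _, (Algebra.commutes _ _).symm⟩
  | add x y _ _ hx hy =>
    obtain ⟨x', hx', ex⟩ := hx
    obtain ⟨y', hy', ey⟩ := hy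
    exact ⟨x' + y', add_mem hx' hy', by rw [mul_add, ex, ey, add_mul]⟩
  | mul x y _ _ hx hy =>
    obtain ⟨x', hx', ex⟩ := hx
    obtain ⟨y', hy', ey⟩ := hy
    exact ⟨x' * y', mul_mem hx' hy', by rw [← mul_assoc, ex, mul_assoc, ey, mul_assoc]⟩

/-- The subset `A_i` of `U^-`. -/
def cmA (i : I) (x : Uq D) : Prop :=
  x ∈ Uminus D ∧ ∃ u ∈ Uminus D, EE D i * x - x * EE D i = u * KK D i

theorem cmA_mul {i : I} {x y : Uq D} (hx : cmA D i x) (hy : cmA D i y) : cmA D i (x * y) := by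
  obtain ⟨mx, u, hu, eu⟩ := hx
  obtain ⟨my, v, hv, ev⟩ := hy
  obtain ⟨y', hy', ey⟩ := cm_KU D i my
  refine ⟨mul_mem mx my, u * y' + x * v, add_mem (mul_mem hu hy') (mul_mem mx hv), ?_⟩
  have : EE D i * (x * y) - (x * y) * EE D i
      = (EE D i * x - x * EE D i) * y + x * (EE D i * y - y * EE D i) := by
    simp only [mul_sub, sub_mul, mul_assoc]; abel
  rw [this, eu, ev, mul_assoc, ey, add_mul, mul_assoc, mul_assoc]

theorem cmA_sub_smul {i : I} {x y : Uq D} (c : 𝕂) (hx : cmA D i x) (hy : cmA D i y) :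
    cmA D i (x - c • y) := by
  obtain ⟨mx, u, hu, eu⟩ := hx
  obtain ⟨my, v, hv, ev⟩ := hy
  refine ⟨sub_mem mx (Subalgebra.smul_mem _ my c), u - c • v,
    sub_mem hu (Subalgebra.smul_mem _ hv c), ?_⟩
  have : EE D i * (x - c • y) - (x - c • y) * EE D i
      = (EE D i * x - x * EE D i) - c • (EE D i * y - y * EE D i) := by
    simp only [mul_sub, sub_mul, smul_sub, mul_smul_comm, smul_mul_assoc]; abel
  rw [this, eu, ev, sub_mul, smul_mul_assoc]

theorem cm_hom_ext (f g : Uq D →ₐ[𝕂] Uq D) (hE : ∀ i, f (EE D i) = g (EE D i))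
    (hF : ∀ i, f (FF D i) = g (FF D i)) (hK : ∀ i, f (KK D i) = g (KK D i)) : f = g := by
  apply RingQuot.ringQuot_ext'
  apply FreeAlgebra.hom_ext
  funext x
  cases x with
  | E i => exact hE i
  | F i => exact hF i
  | K i => exact hK i
  | Kinv i =>
    change f (KKinv D i) = g (KKinv D i)
    have h1 : f (KKinv D i) * f (KK D i) = 1 := by rw [← map_mul, cm_LK, map_one]
    have h2 : g (KK D i) * g (KKinv D i) = 1 := by rw [← map_mul, cm_KL, map_one]
    rw [hK] at h1
    exact left_inv_eq_right_inv h1 h2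


variable {D}

theorem cm_ne_of_adj {i j : I} (h : D.adj i j = true) : i ≠ j := by
  rintro rfl; rw [D.irrefl] at h; cases h

theorem cm_adj_symm {i j : I} (h : D.adj i j = true) : D.adj j i = true := by rw [D.symm]; exact h
theorem cm_far_symm {i j : I} (h : D.adj i j = false) : D.adj j i = false := by
  rw [D.symm]; exact h

variable {T : I → (Uq D ≃ₐ[𝕂] Uq D)}

theorem cm_TFs (hT : IsLusztigAuts D T) (i : I) : T i (FF D i) = -(KKinv D i * EE D i) := (hT i i).1
theorem cm_TFa (hT : IsLusztigAuts D T) {i j : I} (h : D.adj i j = true) :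
    T i (FF D j) = FF D j * FF D i - qq • (FF D i * FF D j) := (hT i j).2.1 h
theorem cm_TFf (hT : IsLusztigAuts D T) {i j : I} (h : i ≠ j) (h' : D.adj i j = false) :
    T i (FF D j) = FF D j := (hT i j).2.2.1 h h'
theorem cm_TEs (hT : IsLusztigAuts D T) (i : I) : T i (EE D i) = -(FF D i * KK D i) :=
  (hT i i).2.2.2.1
theorem cm_TEa (hT : IsLusztigAuts D T) {i j : I} (h : D.adj i j = true) :
    T i (EE D j) = EE D i * EE D j - qq⁻¹ • (EE D j * EE D i) := (hT i j).2.2.2.2.1 h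
theorem cm_TEf (hT : IsLusztigAuts D T) {i j : I} (h : i ≠ j) (h' : D.adj i j = false) :
    T i (EE D j) = EE D j := (hT i j).2.2.2.2.2.1 h h'
theorem cm_TKs (hT : IsLusztigAuts D T) (i : I) : T i (KK D i) = KKinv D i :=
  (hT i i).2.2.2.2.2.2.1
theorem cm_TKa (hT : IsLusztigAuts D T) {i j : I} (h : D.adj i j = true) :
    T i (KK D j) = KK D i * KK D j := (hT i j).2.2.2.2.2.2.2.1 h
theorem cm_TKf (hT : IsLusztigAuts D T) {i j : I} (h : i ≠ j) (h' : D.adj i j = false) :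
    T i (KK D j) = KK D j := (hT i j).2.2.2.2.2.2.2.2 h h'

theorem cm_map_L {x : I} {y : I} (f : Uq D ≃ₐ[𝕂] Uq D) (h : f (KK D x) = KK D y) :
    f (KKinv D x) = KKinv D y := by
  have h1 : f (KKinv D x) * f (KK D x) = 1 := by rw [← map_mul, cm_LK, map_one]
  rw [h] at h1
  exact left_inv_eq_right_inv h1 (cm_KL D y)

theorem cm_map_L' {x : I} {y : I} (f : Uq D ≃ₐ[𝕂] Uq D) (h : f (KK D x) = KKinv D y) :
    f (KKinv D x) = KK D y := by
  have h1 : f (KKinv D x) * f (KK D x) = 1 := by rw [← map_mul, cm_LK, map_one]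
  rw [h] at h1
  exact left_inv_eq_right_inv h1 (cm_LK D y)

theorem cm_TTF (hT : IsLusztigAuts D T) {a b : I} (h : D.adj a b = true) :
    T a (T b (FF D a)) = FF D b := by
  rw [cm_TFa hT (cm_adj_symm h), map_sub, map_smul, map_mul, map_mul, cm_TFs hT, cm_TFa hT h]
  exact cm_XF qq cm_q0 cm_q1 (EE D a) (FF D a) (FF D b) (KK D a) (KKinv D a)
    (cm_EFdiff D (cm_ne_of_adj h)) (cm_EFself D a) (cm_KFadj D h).1 (cm_KFadj D h).2
    (cm_KFself D a).2 (cm_LK D a)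

theorem cm_TTE (hT : IsLusztigAuts D T) {a b : I} (h : D.adj a b = true) :
    T a (T b (EE D a)) = EE D b := by
  rw [cm_TEa hT (cm_adj_symm h), map_sub, map_smul, map_mul, map_mul, cm_TEs hT, cm_TEa hT h]
  exact cm_XE qq cm_q0 cm_q1 (EE D a) (EE D b) (FF D a) (KK D a) (KKinv D a)
    (cm_EFdiff D (cm_ne_of_adj h).symm) (cm_EFself D a) (cm_KEadj D h).1 (cm_KEadj D h).2
    (cm_KEself D a) (cm_LK D a)

theorem cm_TTK (hT : IsLusztigAuts D T) {a b : I} (h : D.adj a b = true) :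
    T a (T b (KK D a)) = KK D b := by
  rw [cm_TKa hT (cm_adj_symm h), map_mul, cm_TKs hT, cm_TKa hT h, cm_KK D a b, mul_assoc, cm_KL,
    mul_one]

theorem cm_TTL (hT : IsLusztigAuts D T) {a b : I} (h : D.adj a b = true) :
    T a (T b (KKinv D a)) = KKinv D b :=
  cm_map_L ((T b).trans (T a)) (cm_TTK hT h)

def cmBr (T : I → (Uq D ≃ₐ[𝕂] Uq D)) (a b : I) (x : Uq D) : Prop :=
  T a (T b (T a x)) = T b (T a (T b x))

def cmBrk (T : I → (Uq D ≃ₐ[𝕂] Uq D)) (a b k : I) : Prop :=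
  cmBr T a b (EE D k) ∧ cmBr T a b (FF D k) ∧ cmBr T a b (KK D k)

theorem cm_br_symm {a b k : I} (h : cmBrk T a b k) : cmBrk T b a k :=
  ⟨h.1.symm, h.2.1.symm, h.2.2.symm⟩

theorem cm_br1 (hT : IsLusztigAuts D T) {a b : I} (h : D.adj a b = true) : cmBrk T a b a := by
  refine ⟨?_, ?_, ?_⟩ <;> unfold cmBr
  · rw [cm_TTE hT h, cm_TEs hT, cm_TEs hT, map_neg, map_neg, map_mul, map_mul, cm_TTF hT h,
      cm_TTK hT h]
  · rw [cm_TTF hT h, cm_TFs hT, cm_TFs hT, map_neg, map_neg, map_mul, map_mul, cm_TTE hT h,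
      cm_TTL hT h]
  · rw [cm_TTK hT h, cm_TKs hT, cm_TKs hT, cm_TTL hT h]

theorem cm_br2 (hT : IsLusztigAuts D T) {a b k : I} (h : D.adj a b = true) (hk : D.adj a k = true)
    (hkb : b ≠ k) : cmBrk T a b k := by
  have hf : D.adj b k = false := cm_no_triangle D h hk
  refine ⟨?_, ?_, ?_⟩ <;> unfold cmBr
  · rw [cm_TEf hT hkb hf, cm_TEa hT hk]
    simp only [map_sub, map_smul, map_mul]
    rw [cm_TTE hT h, cm_TEf hT hkb hf, cm_TEa hT hk, cm_TEa hT (cm_adj_symm h)]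
    exact cm_YE _ _ _ _ (cm_EEfar D hkb hf).symm
  · rw [cm_TFf hT hkb hf, cm_TFa hT hk]
    simp only [map_sub, map_smul, map_mul]
    rw [cm_TTF hT h, cm_TFf hT hkb hf, cm_TFa hT hk, cm_TFa hT (cm_adj_symm h)]
    exact cm_Y _ _ _ _ (cm_FFfar D hkb hf).symm
  · rw [cm_TKf hT hkb hf, cm_TKa hT hk]
    simp only [map_mul]
    rw [cm_TTK hT h, cm_TKf hT hkb hf, cm_TKa hT hk, cm_TKa hT (cm_adj_symm h), mul_assoc]

theorem cm_br (hT : IsLusztigAuts D T) {a b : I} (h : D.adj a b = true) (k : I) :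
    cmBrk T a b k := by
  by_cases hka : a = k
  · subst hka; exact cm_br1 hT h
  by_cases hkb : b = k
  · subst hkb; exact cm_br_symm (cm_br1 hT (cm_adj_symm h))
  cases h1 : D.adj a k with
  | true => exact cm_br2 hT h h1 hkb
  | false =>
    cases h2 : D.adj b k with
    | true => exact cm_br_symm (cm_br2 hT (cm_adj_symm h) h2 hka)
    | false =>
      refine ⟨?_, ?_, ?_⟩ <;> unfold cmBr
      · simp only [cm_TEf hT hka h1, cm_TEf hT hkb h2]
      · simp only [cm_TFf hT hka h1, cm_TFf hT hkb h2]
      · simp only [cm_TKf hT hka h1, cm_TKf hT hkb h2]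

theorem cm_braid3 (hT : IsLusztigAuts D T) {a b : I} (h : D.adj a b = true) (x : Uq D) :
    T a (T b (T a x)) = T b (T a (T b x)) := by
  have := cm_hom_ext D (((T a).trans (T b)).trans (T a) : Uq D ≃ₐ[𝕂] Uq D).toAlgHom
    (((T b).trans (T a)).trans (T b) : Uq D ≃ₐ[𝕂] Uq D).toAlgHom
    (fun k => (cm_br hT h k).1) (fun k => (cm_br hT h k).2.1) (fun k => (cm_br hT h k).2.2)
  exact congrArg (fun f : Uq D →ₐ[𝕂] Uq D => f x) this

def cmCok (T : I → (Uq D ≃ₐ[𝕂] Uq D)) (a b k : I) : Prop :=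
  T a (T b (EE D k)) = T b (T a (EE D k)) ∧ T a (T b (FF D k)) = T b (T a (FF D k)) ∧
    T a (T b (KK D k)) = T b (T a (KK D k))

theorem cm_co_symm {a b k : I} (h : cmCok T a b k) : cmCok T b a k :=
  ⟨h.1.symm, h.2.1.symm, h.2.2.symm⟩

theorem cm_co1 (hT : IsLusztigAuts D T) {a b : I} (hab : a ≠ b) (h : D.adj a b = false) :
    cmCok T a b a := by
  have hL : T b (KKinv D a) = KKinv D a := cm_map_L _ (cm_TKf hT hab.symm (cm_far_symm h))
  refine ⟨?_, ?_, ?_⟩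
  · rw [cm_TEf hT hab.symm (cm_far_symm h), cm_TEs hT, map_neg, map_mul,
      cm_TFf hT hab.symm (cm_far_symm h), cm_TKf hT hab.symm (cm_far_symm h)]
  · rw [cm_TFf hT hab.symm (cm_far_symm h), cm_TFs hT, map_neg, map_mul,
      cm_TEf hT hab.symm (cm_far_symm h), hL]
  · rw [cm_TKf hT hab.symm (cm_far_symm h), cm_TKs hT, hL]

theorem cm_co2 (hT : IsLusztigAuts D T) {a b k : I} (hab : a ≠ b) (h : D.adj a b = false)
    (hk : D.adj a k = true) (hbk : b ≠ k) : cmCok T a b k := by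
  cases h2 : D.adj b k with
  | true =>
    have h' := cm_far_symm h
    refine ⟨?_, ?_, ?_⟩
    · rw [cm_TEa hT hk, cm_TEa hT h2]
      simp only [map_sub, map_smul, map_mul]
      rw [cm_TEa hT hk, cm_TEa hT h2, cm_TEf hT hab h, cm_TEf hT hab.symm h']
      exact cm_ZE _ _ _ _ (cm_EEfar D hab h)
    · rw [cm_TFa hT hk, cm_TFa hT h2]
      simp only [map_sub, map_smul, map_mul]
      rw [cm_TFa hT hk, cm_TFa hT h2, cm_TFf hT hab h, cm_TFf hT hab.symm h']
      exact cm_Z _ _ _ _ (cm_FFfar D hab h)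
    · rw [cm_TKa hT hk, cm_TKa hT h2]
      simp only [map_mul]
      rw [cm_TKa hT hk, cm_TKa hT h2, cm_TKf hT hab h, cm_TKf hT hab.symm h', ← mul_assoc,
        ← mul_assoc, cm_KK D a b]
  | false =>
    have h' := cm_far_symm h
    refine ⟨?_, ?_, ?_⟩
    · rw [cm_TEa hT hk, cm_TEf hT hbk h2]
      simp only [map_sub, map_smul, map_mul]
      rw [cm_TEa hT hk, cm_TEf hT hbk h2, cm_TEf hT hab.symm h']
    · rw [cm_TFa hT hk, cm_TFf hT hbk h2]
      simp only [map_sub, map_smul, map_mul]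
      rw [cm_TFa hT hk, cm_TFf hT hbk h2, cm_TFf hT hab.symm h']
    · rw [cm_TKa hT hk, cm_TKf hT hbk h2]
      simp only [map_mul]
      rw [cm_TKa hT hk, cm_TKf hT hbk h2, cm_TKf hT hab.symm h']

theorem cm_co (hT : IsLusztigAuts D T) {a b : I} (hab : a ≠ b) (h : D.adj a b = false) (k : I) :
    cmCok T a b k := by
  by_cases hka : a = k
  · subst hka; exact cm_co1 hT hab h
  by_cases hkb : b = k
  · subst hkb; exact cm_co_symm (cm_co1 hT hab.symm (cm_far_symm h))
  cases h1 : D.adj a k with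
  | true => exact cm_co2 hT hab h h1 hkb
  | false =>
    cases h2 : D.adj b k with
    | true => exact cm_co_symm (cm_co2 hT hab.symm (cm_far_symm h) h2 hka)
    | false =>
      refine ⟨?_, ?_, ?_⟩
      · simp only [cm_TEf hT hka h1, cm_TEf hT hkb h2]
      · simp only [cm_TFf hT hka h1, cm_TFf hT hkb h2]
      · simp only [cm_TKf hT hka h1, cm_TKf hT hkb h2]

theorem cm_braid2 (hT : IsLusztigAuts D T) {a b : I} (hab : a ≠ b) (h : D.adj a b = false)
    (x : Uq D) : T a (T b x) = T b (T a x) := by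
  have := cm_hom_ext D ((T b).trans (T a) : Uq D ≃ₐ[𝕂] Uq D).toAlgHom
    ((T a).trans (T b) : Uq D ≃ₐ[𝕂] Uq D).toAlgHom
    (fun k => (cm_co hT hab h k).1) (fun k => (cm_co hT hab h k).2.1)
    (fun k => (cm_co hT hab h k).2.2)
  exact congrArg (fun f : Uq D →ₐ[𝕂] Uq D => f x) this

/-- `T` along a word, as an automorphism. -/
noncomputable def cmT (T : I → (Uq D ≃ₐ[𝕂] Uq D)) : List I → (Uq D ≃ₐ[𝕂] Uq D)
  | [] => AlgEquiv.refl
  | i :: l => (cmT T l).trans (T i)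

theorem cmT_cons (a : I) (u : List I) (x : Uq D) : cmT T (a :: u) x = T a (cmT T u x) := rfl

theorem cmT_nil (x : Uq D) : cmT T [] x = x := rfl

theorem cmT_append (u v : List I) (x : Uq D) : cmT T (u ++ v) x = cmT T u (cmT T v x) := by
  induction u with
  | nil => rfl
  | cons a u ih => rw [List.cons_append, cmT_cons, cmT_cons, ih]

theorem cmT_apply (u : List I) (x : Uq D) : applyT T u x = cmT T u x := by
  induction u with
  | nil => rfl
  | cons a u ih => rw [cmT_cons, ← ih]; rfl

/-- Matsumoto. -/
theorem cm_matsumoto (hT : IsLusztigAuts D T) (n : ℕ) : ∀ u v : List I, u.length = n →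
    IsReducedWord D u → IsReducedWord D v → wordAct D u = wordAct D v →
    ∀ x, cmT T u x = cmT T v x := by
  induction n with
  | zero =>
    intro u v hn hu hv he x
    have hvl := hv u he
    have hu0 := List.length_eq_zero_iff.1 hn
    have hv0 : v = [] := List.length_eq_zero_iff.1 (by omega)
    rw [hu0, hv0]
  | succ n ih =>
    intro u v hn hu hv he x
    have hlen : u.length = v.length := le_antisymm (hu v he.symm) (hv u he)
    obtain ⟨a, u, rfl⟩ := List.exists_cons_of_length_eq_add_one hn
    obtain ⟨b, v, rfl⟩ := List.exists_cons_of_length_eq_add_one (hlen.symm.trans hn)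
    simp only [List.length_cons, Nat.add_right_cancel_iff] at hn hlen
    have hu' := cm_red_tail D hu
    have hv' := cm_red_tail D hv
    by_cases hab : a = b
    · subst hab
      rw [cmT_cons, cmT_cons, ih u v hn hu' hv' (cm_wa_cons_cancel D a he)]
    have hr := cm_wa_rev_congr D he
    -- action of the inverse
    have hra : ∀ y, wordAct D u.reverse y = wordAct D (b :: v).reverse (sref D a y) := by
      intro y
      rw [← hr, List.reverse_cons, cm_wa_append]
      change _ = wordAct D u.reverse (sref D a (sref D a y))
      rw [cm_sref_sref]
    have hnb : cmPos (-(wordAct D (b :: v).reverse (simpleRoot b))) := by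
      rw [List.reverse_cons, cm_wa_append]
      change cmPos (-(wordAct D v.reverse (sref D b (simpleRoot b))))
      rw [cm_sref_self, cm_wa_neg, neg_neg]
      exact cm_red_cons_pos D hv
    have hna : cmPos (-(wordAct D (b :: v).reverse (simpleRoot a))) := by
      rw [← hr, List.reverse_cons, cm_wa_append]
      change cmPos (-(wordAct D u.reverse (sref D a (simpleRoot a))))
      rw [cm_sref_self, cm_wa_neg, neg_neg]
      exact cm_red_cons_pos D hu
    cases hadj : D.adj a b with
    | false =>
      obtain ⟨u2, hl2, he2⟩ := cm_exch D u b (by rw [hra, cm_sref_far D hab hadj]; exact hnb)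
      have e3 : wordAct D (a :: u2) = wordAct D v := by
        apply cm_wa_cons_cancel D b
        rw [← he]
        rw [← cm_wa_cons_congr D a he2]
        funext y
        change sref D b (sref D a _) = sref D a (sref D b _)
        have c1 := cm_conj D [a] b b (cm_sref_far D hab hadj)
        exact congrFun c1 (wordAct D u2 y)
      rw [cmT_cons, cmT_cons, ← ih (b :: u2) u (by simp; omega)
        (cm_red_congr D hu' he2 (by simp; omega)) hu' he2,
        ih v (a :: u2) (by omega) hv' (cm_red_congr D hv' e3 (by simp; omega)) e3.symm,
        cmT_cons, cmT_cons, cm_braid2 hT hab hadj]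
    | true =>
      have hadj' := cm_adj_symm hadj
      obtain ⟨u2, hl2, he2⟩ := cm_exch D u b (by
        rw [hra, cm_sref_adj D hadj, cm_wa_add, neg_add]
        intro j; exact add_nonneg (hna j) (hnb j))
      have hr2 := cm_wa_rev_congr D he2
      obtain ⟨u3, hl3, he3⟩ := cm_exch D u2 a (by
        have : wordAct D u2.reverse (simpleRoot a)
            = wordAct D (b :: v).reverse (simpleRoot b) := by
          have e1 : wordAct D u2.reverse (simpleRoot a)
              = wordAct D u.reverse (sref D b (simpleRoot a)) := by
            rw [← hr2, List.reverse_cons, cm_wa_append]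
            change _ = wordAct D u2.reverse (sref D b (sref D b _))
            rw [cm_sref_sref]
          rw [e1, hra, cm_sref_adj D hadj', ← cm_sref_adj D (i := a) (j := b) hadj |>.trans
            (add_comm _ _), cm_sref_sref]
        rw [this]; exact hnb)
      have e4 : wordAct D (b :: a :: u3) = wordAct D u :=
        (cm_wa_cons_congr D b he3).trans he2
      have e5 : wordAct D (a :: b :: u3) = wordAct D v := by
        apply cm_wa_cons_cancel D b
        rw [← he, ← cm_wa_cons_congr D a e4]
        have c1 := cm_conj D [a, b] b a (by
          change sref D a (sref D b (simpleRoot a)) = simpleRoot b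
          rw [cm_sref_adj D hadj', ← cm_sref_adj D (i := a) (j := b) hadj |>.trans
            (add_comm _ _), cm_sref_sref])
        funext y
        exact congrFun c1 (wordAct D u3 y)
      rw [cmT_cons, cmT_cons, ← ih (b :: a :: u3) u (by simp; omega)
        (cm_red_congr D hu' e4 (by simp; omega)) hu' e4,
        ih v (a :: b :: u3) (by omega) hv' (cm_red_congr D hv' e5 (by simp; omega)) e5.symm]
      simp only [cmT_cons]
      rw [cm_braid3 hT hadj]

theorem cm_mats (hT : IsLusztigAuts D T) {u v : List I}
    (hu : IsReducedWord D u) (hv : IsReducedWord D v) (h : wordAct D u = wordAct D v) (x : Uq D) :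
    cmT T u x = cmT T v x := cm_matsumoto hT u.length u v rfl hu hv h x

end CMuq

section CMmain

variable {I : Type} [Fintype I] [DecidableEq I] {D : ADEData I}
variable {T : I → (Uq D ≃ₐ[𝕂] Uq D)}

theorem cm_decomp (hT : IsLusztigAuts D T) (u : List I) (hu : IsReducedWord D u) (hne : u ≠ [])
    (m : I) (hm : cmPos (wordAct D u (simpleRoot m))) :
    ∃ (n : I) (u' : List I), n ≠ m ∧ IsReducedWord D u' ∧ u'.length < u.length ∧
      cmPos (wordAct D u' (simpleRoot n)) ∧ cmPos (wordAct D u' (simpleRoot m)) ∧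
      ((wordAct D u = wordAct D (u' ++ [n]) ∧ ∀ x, cmT T u x = cmT T u' (T n x)) ∨
       (D.adj n m = true ∧ wordAct D u = wordAct D (u' ++ [m, n]) ∧
          ∀ x, cmT T u x = cmT T u' (T m (T n x)))) := by
  obtain ⟨u1, n, rfl⟩ : ∃ u1 n, u = u1 ++ [n] :=
    ⟨u.dropLast, u.getLast hne, (List.dropLast_append_getLast hne).symm⟩
  have hu1 := cm_red_prefix D hu
  have hpn := cm_red_snoc_pos D hu
  have hnm : n ≠ m := by
    rintro rfl
    rw [cm_wa_append] at hm
    change cmPos (wordAct D u1 (sref D n (simpleRoot n))) at hm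
    rw [cm_sref_self, cm_wa_neg] at hm
    exact cm_not_both D (cm_rt_wa D u1 n) hpn hm
  rcases cm_dich D (cm_rt_wa D u1 m) with hp | hn
  · exact ⟨n, u1, hnm, hu1, by simp, hpn, hp, Or.inl ⟨rfl, fun x => by rw [cmT_append]; rfl⟩⟩
  · have hadj : D.adj n m = true := by
      by_contra h
      rw [Bool.not_eq_true] at h
      rw [cm_wa_append] at hm
      change cmPos (wordAct D u1 (sref D n (simpleRoot m))) at hm
      rw [cm_sref_far D hnm h] at hm
      exact cm_not_both D (cm_rt_wa D u1 m) hm hn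
    obtain ⟨u2, hl, he⟩ := cm_exch_right D u1 m hn
    have hr : IsReducedWord D (u2 ++ [m]) := cm_red_congr D hu1 he (by simp; omega)
    have hu2 := cm_red_prefix D hr
    have hw : wordAct D (u1 ++ [n]) = wordAct D (u2 ++ [m, n]) := by
      funext x
      rw [cm_wa_append, ← he, cm_wa_append, cm_wa_append]; rfl
    have hpn2 : cmPos (wordAct D u2 (simpleRoot n)) := by
      rw [hw, cm_wa_append] at hm
      change cmPos (wordAct D u2 (sref D m (sref D n (simpleRoot m)))) at hm
      rw [cm_sref_adj D hadj, add_comm, ← cm_sref_adj D (cm_adj_symm hadj), cm_sref_sref] at hm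
      exact hm
    refine ⟨n, u2, hnm, hu2, by simp; omega, hpn2, cm_red_snoc_pos D hr,
      Or.inr ⟨hadj, hw, fun x => ?_⟩⟩
    rw [cmT_append, cm_mats hT hu1 hr he.symm, cmT_append]; rfl

theorem cm_claimA (hT : IsLusztigAuts D T) (n : ℕ) : ∀ u : List I, u.length = n →
    IsReducedWord D u → ∀ m, cmPos (wordAct D u (simpleRoot m)) →
    cmT T u (FF D m) ∈ Uminus D := by
  induction n using Nat.strong_induction_on with
  | _ n ih =>
    intro u hn hu m hm
    by_cases hne : u = []
    · subst hne; exact cm_FF_mem D m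
    obtain ⟨n', u', hnm, hu', hl, pn, pm, ⟨-, ht⟩ | ⟨hadj, -, ht⟩⟩ := cm_decomp hT u hu hne m hm
    · have hn' := ih u'.length (by omega) u' rfl hu' n' pn
      have hm' := ih u'.length (by omega) u' rfl hu' m pm
      rw [ht]
      cases hadj : D.adj n' m with
      | false => rw [cm_TFf hT hnm hadj]; exact hm'
      | true =>
        rw [cm_TFa hT hadj, map_sub, map_smul, map_mul, map_mul]
        exact sub_mem (mul_mem hm' hn') (Subalgebra.smul_mem _ (mul_mem hn' hm') _)
    · rw [ht, cm_TTF hT (cm_adj_symm hadj)]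
      exact ih u'.length (by omega) u' rfl hu' n' pn

theorem cm_claimB (hT : IsLusztigAuts D T) (n : ℕ) : ∀ u : List I, u.length = n →
    IsReducedWord D u → ∀ m i, wordAct D u (simpleRoot m) = simpleRoot i →
    cmT T u (EE D m) = EE D i ∧ cmT T u (KK D m) = KK D i := by
  induction n using Nat.strong_induction_on with
  | _ n ih =>
    intro u hn hu m i hm
    by_cases hne : u = []
    · subst hne
      have : m = i := by
        have := congrFun hm m
        simp only [wordAct, simpleRoot] at this
        by_contra hc
        simp [hc] at this
      subst this; exact ⟨rfl, rfl⟩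
    obtain ⟨n', u', hnm, hu', hl, pn, pm, ⟨hw, ht⟩ | ⟨hadj, hw, ht⟩⟩ :=
      cm_decomp hT u hu hne m (by rw [hm]; exact cm_simple_pos i)
    · rw [hw, cm_wa_append] at hm
      change wordAct D u' (sref D n' (simpleRoot m)) = _ at hm
      cases hadj : D.adj n' m with
      | false =>
        rw [cm_sref_far D hnm hadj] at hm
        rw [ht, ht, cm_TEf hT hnm hadj, cm_TKf hT hnm hadj]
        exact ih u'.length (by omega) u' rfl hu' m i hm
      | true =>
        rw [cm_sref_adj D hadj, cm_wa_add] at hm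
        exact (cm_sum_not_simple D (cm_rt_wa D u' n') (cm_rt_wa D u' m) pn pm i hm).elim
    · rw [hw, cm_wa_append] at hm
      change wordAct D u' (sref D m (sref D n' (simpleRoot m))) = _ at hm
      rw [cm_sref_adj D hadj, add_comm, ← cm_sref_adj D (cm_adj_symm hadj), cm_sref_sref] at hm
      rw [ht, ht, cm_TTE hT (cm_adj_symm hadj), cm_TTK hT (cm_adj_symm hadj)]
      exact ih u'.length (by omega) u' rfl hu' n' i hm

theorem cm_claimC (hT : IsLusztigAuts D T) (i : I) (n : ℕ) : ∀ u : List I, u.length = n →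
    IsReducedWord D u → cmPos (-(wordAct D u.reverse (simpleRoot i))) →
    ∀ m, cmPos (wordAct D u (simpleRoot m)) → cmA D i (cmT T u (FF D m)) := by
  induction n using Nat.strong_induction_on with
  | _ n ih =>
    intro u hn hu hi m hm
    have hmem := cm_claimA hT u.length u rfl hu m hm
    by_cases hne : u = []
    · subst hne
      exact (cm_not_both D (cm_rt_simple D i) (cm_simple_pos i) hi).elim
    obtain ⟨n', u', hnm, hu', hl, pn, pm, ⟨hw, ht⟩ | ⟨hadj, hw, ht⟩⟩ := cm_decomp hT u hu hne m hm
    · rw [cm_wa_rev_congr D hw, List.reverse_append] at hi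
      change cmPos (-(sref D n' (wordAct D u'.reverse (simpleRoot i)))) at hi
      rcases cm_dich D (cm_rt_wa D u'.reverse i) with hp | hneg
      · have e := cm_eq_simple D (cm_rt_wa D u'.reverse i) hp n' hi
        have e' : wordAct D u' (simpleRoot n') = simpleRoot i := by rw [← e, cm_wa_rev2]
        obtain ⟨eE, eK⟩ := cm_claimB hT u'.length u' rfl hu' n' i e'
        refine ⟨hmem, ?_⟩
        rw [ht, ← eE, ← map_mul, ← map_mul, ← map_sub, ← eK]
        cases hadj : D.adj n' m with
        | false =>
          refine ⟨0, zero_mem _, ?_⟩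
          rw [cm_TFf hT hnm hadj, cm_EFdiff D hnm, sub_self, map_zero, zero_mul]
        | true =>
          refine ⟨(-qq) • cmT T u' (FF D m),
            Subalgebra.smul_mem _ (cm_claimA hT u'.length u' rfl hu' m pm) _, ?_⟩
          rw [cm_TFa hT hadj, cm_R1 qq cm_q0 cm_q1 (EE D n') (FF D n') (FF D m) (KK D n')
            (KKinv D n') (cm_EFdiff D hnm) (cm_EFself D n') (cm_KFadj D hadj).1
            (cm_KFadj D hadj).2, map_smul, map_mul, smul_mul_assoc]
      · have hn' := ih u'.length (by omega) u' rfl hu' hneg n' pn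
        have hm' := ih u'.length (by omega) u' rfl hu' hneg m pm
        rw [ht]
        cases hadj : D.adj n' m with
        | false => rw [cm_TFf hT hnm hadj]; exact hm'
        | true =>
          rw [cm_TFa hT hadj, map_sub, map_smul, map_mul, map_mul]
          exact cmA_sub_smul D _ (cmA_mul D hm' hn') (cmA_mul D hn' hm')
    · rw [cm_wa_rev_congr D hw, List.reverse_append] at hi
      change cmPos (-(sref D n' (sref D m (wordAct D u'.reverse (simpleRoot i))))) at hi
      have ht' : cmT T u (FF D m) = cmT T u' (FF D n') := by
        rw [ht, cm_TTF hT (cm_adj_symm hadj)]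
      rcases cm_dich D (cm_rt_wa D u'.reverse i) with hp | hneg
      · have hrt : cmRt D (sref D m (wordAct D u'.reverse (simpleRoot i))) :=
          cm_rt_wa D (m :: u'.reverse) i
        rcases cm_dich D hrt with hp2 | hneg2
        · have e := cm_eq_simple D hrt hp2 n' hi
          have e2 : wordAct D u'.reverse (simpleRoot i) = simpleRoot m + simpleRoot n' := by
            rw [← cm_sref_adj D (cm_adj_symm hadj), ← e, cm_sref_sref]
          have e3 : wordAct D u' (simpleRoot m) + wordAct D u' (simpleRoot n') = simpleRoot i := by
            rw [← cm_wa_add, ← e2, cm_wa_rev2]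
          exact (cm_sum_not_simple D (cm_rt_wa D u' m) (cm_rt_wa D u' n') pm pn i e3).elim
        · have e := cm_eq_simple D (cm_rt_wa D u'.reverse i) hp m hneg2
          have e' : wordAct D u' (simpleRoot m) = simpleRoot i := by rw [← e, cm_wa_rev2]
          obtain ⟨eE, eK⟩ := cm_claimB hT u'.length u' rfl hu' m i e'
          refine ⟨hmem, 0, zero_mem _, ?_⟩
          rw [ht', ← eE, ← map_mul, ← map_mul, ← map_sub, cm_EFdiff D hnm.symm, sub_self,
            map_zero, zero_mul]
      · rw [ht']
        exact ih u'.length (by omega) u' rfl hu' hneg n' pn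

end CMmain

/-- If `β_j = α_i` is a simple root, then for all `k > j` the
commutator `E_i F_{β_k} - F_{β_k} E_i` lies in `U_q^-(𝔤) K_i`. -/
theorem commutator_mem_Uminus_K
    {I : Type} [Fintype I] [DecidableEq I] (D : ADEData I)
    (T : I → (Uq D ≃ₐ[𝕂] Uq D)) (hT : IsLusztigAuts D T)
    (w : List I) (hw : IsRedW0 D w)
    (j : Fin w.length) (i : I) (hj : beta D w j = simpleRoot i) :
    ∀ k : Fin w.length, j < k →
      ∃ u ∈ Uminus D,
        EE D i * rootVec T w k - rootVec T w k * EE D i = u * KK D i := by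
  intro k hjk
  have hred := hw.1
  have hlt : (j : ℕ) < (k : ℕ) := hjk
  have hk := k.2
  have hpos : cmPos (wordAct D (w.take k) (simpleRoot (w.get k))) := by
    apply cm_red_snoc_pos D
    have e : w = (w.take k ++ [w.get k]) ++ w.drop (k + 1) := by
      rw [List.append_assoc, List.singleton_append, List.get_eq_getElem, ← List.drop_eq_getElem_cons,
        List.take_append_drop]
    rw [e] at hred
    exact cm_red_prefix D hred
  have hredk : IsReducedWord D (w.take k) := by
    rw [← List.take_append_drop k w] at hred
    exact cm_red_prefix D hred
  have hneg : cmPos (-(wordAct D (w.take k).reverse (simpleRoot i))) := by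
    have e : w.take k = w.take j ++ (w.get j :: (w.take k).drop (j + 1)) := by
      have hj' : (j : ℕ) < (w.take k).length := by rw [List.length_take]; omega
      have h1 : w.take j = (w.take k).take j := by rw [List.take_take, min_eq_left hlt.le]
      have h2 : w.get j = (w.take k)[(j : ℕ)] := by simp
      rw [h1, h2, ← List.drop_eq_getElem_cons, List.take_append_drop]
    generalize (w.take k).drop (j + 1) = r at e
    rw [e] at hredk ⊢
    have hp := cm_red_cons_pos D (cm_red_suffix D hredk)
    unfold beta at hj
    rw [List.reverse_append, List.reverse_cons, cm_wa_append, ← hj, cm_wa_rev, cm_wa_append]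
    change cmPos (-(wordAct D r.reverse (sref D _ (simpleRoot _))))
    rw [cm_sref_self, cm_wa_neg, neg_neg]
    exact hp
  have := (cm_claimC hT i _ (w.take k) rfl hredk hneg (w.get k) hpos).2
  unfold rootVec
  rw [cmT_apply]
  exact this
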